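/- Let M and N be real d×d matrices, let m_i denote the i-th column of M and n_i the i-th row of N, and set s_i = ‖m_i‖₂·‖n_i‖₂ for i = 1, …, d. Let S be the d×k column selection matrix selecting the k indices with the largest scores s_i. Then ‖MN − MSSᵀN‖_F ≤ ((d−k)/d) · ‖M‖_F · ‖N‖_F. -/

import Mathlib

open Matrix BigOperators

noncomputable section

/-- Squared Frobenius norm of a real matrix: `‖A‖_F² = ∑ᵢⱼ Aᵢⱼ²`. -/
def frobSq {m n : Type*} [Fintype m] [Fintype n] (A : Matrix m n ℝ) : ℝ :=
  ∑ i, ∑ j, (A i j) ^ 2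

/-- Frobenius norm of a real matrix. -/
def frobNorm {m n : Type*} [Fintype m] [Fintype n] (A : Matrix m n ℝ) : ℝ :=
  Real.sqrt (frobSq A)

/-- Spectral norm (ℓ²→ℓ² operator norm, largest singular value) of a real matrix. -/
def specNorm {m n : Type*} [Fintype m] [Fintype n] [DecidableEq n] (A : Matrix m n ℝ) : ℝ :=
  ‖LinearMap.toContinuousLinearMap (Matrix.toEuclideanLin A)‖

/-- `S` is a `k`-column selection matrix whose columns are the distinct standard basis
vectors indexed by the injective map `f`. -/
def IsColSel {d k : ℕ} (f : Fin k → Fin d) (S : Matrix (Fin d) (Fin k) ℝ) : Prop :=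
  Function.Injective f ∧ ∀ i j, S i j = if i = f j then 1 else 0

theorem frobNorm_eq_norm {m n : Type*} [Fintype m] [Fintype n] (A : Matrix m n ℝ) :
    frobNorm A = Matrix.frobeniusNormedAddCommGroup.toNorm.norm A := by
  rw [Matrix.frobenius_norm_def, ← Real.sqrt_eq_rpow]
  simp [frobNorm, frobSq]

theorem frobNorm_sum_le {ι m n : Type*} [Fintype m] [Fintype n] (U : Finset ι)
    (A : ι → Matrix m n ℝ) : frobNorm (∑ i ∈ U, A i) ≤ ∑ i ∈ U, frobNorm (A i) := by
  simp only [frobNorm_eq_norm]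
  let _ : NormedAddCommGroup (Matrix m n ℝ) := Matrix.frobeniusNormedAddCommGroup
  exact norm_sum_le U A

theorem frobNorm_vecMulVec {m n : Type*} [Fintype m] [Fintype n] (a : m → ℝ) (b : n → ℝ) :
    frobNorm (vecMulVec a b) = Real.sqrt (∑ i, a i ^ 2) * Real.sqrt (∑ j, b j ^ 2) := by
  rw [← Real.sqrt_mul (Finset.sum_nonneg fun _ _ => sq_nonneg _), Finset.sum_mul_sum]
  simp only [frobNorm, frobSq, vecMulVec_apply, mul_pow]

/-- The entries left out of a selection of largest entries have at most the overall average. -/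
theorem card_mul_sum_compl_le {ι : Type*} [Fintype ι] [DecidableEq ι] (T : Finset ι) (s : ι → ℝ)
    (h : ∀ i ∈ Tᶜ, ∀ j ∈ T, s i ≤ s j) :
    (Fintype.card ι : ℝ) * ∑ i ∈ Tᶜ, s i ≤ (Tᶜ.card : ℝ) * ∑ i, s i := by
  have hsum : (T.card : ℝ) * ∑ i ∈ Tᶜ, s i ≤ (Tᶜ.card : ℝ) * ∑ j ∈ T, s j := by
    have := Finset.sum_le_sum fun i hi => Finset.sum_le_sum fun j hj => h i hi j hj
    simpa [Finset.mul_sum] using this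
  have hcard : (Fintype.card ι : ℝ) = T.card + Tᶜ.card := by
    exact_mod_cast (Finset.card_add_card_compl T).symm
  rw [hcard, ← Finset.sum_add_sum_compl T s]
  linarith

theorem IsColSel.mul_sub_eq_sum {d k : ℕ} {f : Fin k → Fin d} {S : Matrix (Fin d) (Fin k) ℝ}
    (hS : IsColSel f S) (M N : Matrix (Fin d) (Fin d) ℝ) :
    M * N - M * S * Sᵀ * N =
      ∑ i ∈ (Finset.univ.image f)ᶜ, vecMulVec (fun a => M a i) (N i) := by
  have hMS : ∀ a j, (M * S) a j = M a (f j) := fun a j => by simp [mul_apply, hS.2]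
  have hSN : ∀ j b, (Sᵀ * N) j b = N (f j) b := fun j b => by simp [mul_apply, hS.2]
  ext a b
  rw [Matrix.mul_assoc (M * S), Matrix.sub_apply, mul_apply, mul_apply, Matrix.sum_apply]
  simp only [hMS, hSN, vecMulVec_apply]
  rw [← Finset.sum_add_sum_compl (Finset.univ.image f), Finset.sum_image hS.1.injOn]
  ring

/-- Deterministic CR-decomposition error bound: selecting the `k` columns/rows with
largest norm-product scores gives `‖MN − MSSᵀN‖_F ≤ ((d−k)/d)‖M‖_F‖N‖_F`. -/
theorem CR_decomposition_error
    {d k : ℕ} (M N : Matrix (Fin d) (Fin d) ℝ)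
    (s : Fin d → ℝ)
    (hs : ∀ i, s i = Real.sqrt (∑ j, M j i ^ 2) * Real.sqrt (∑ j, N i j ^ 2))
    (f : Fin k → Fin d) (S : Matrix (Fin d) (Fin k) ℝ) (hS : IsColSel f S)
    (htop : ∀ i ∈ Finset.univ \ Finset.image f Finset.univ, ∀ j : Fin k, s i ≤ s (f j)) :
    frobNorm (M * N - M * S * Sᵀ * N) ≤
      (((d : ℝ) - (k : ℝ)) / (d : ℝ)) * frobNorm M * frobNorm N := by
  have hT : (((Finset.univ.image f)ᶜ).card : ℝ) = d - k := by
    have h := Finset.card_add_card_compl (Finset.univ.image f)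
    rw [Finset.card_image_of_injective _ hS.1, Finset.card_fin, Fintype.card_fin] at h
    rw [eq_sub_iff_add_eq']
    exact_mod_cast h
  have herr : frobNorm (M * N - M * S * Sᵀ * N) ≤ ∑ i ∈ (Finset.univ.image f)ᶜ, s i := by
    rw [hS.mul_sub_eq_sum]
    refine (frobNorm_sum_le _ _).trans_eq (Finset.sum_congr rfl fun i _ => ?_)
    rw [frobNorm_vecMulVec, hs]
  have havg := card_mul_sum_compl_le (Finset.univ.image f) s fun i hi j hj => by
    obtain ⟨l, -, rfl⟩ := Finset.mem_image.1 hj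
    exact htop i (by simpa using hi) l
  rw [hT, Fintype.card_fin] at havg
  have hcs : ∑ i, s i ≤ frobNorm M * frobNorm N := by
    simp only [hs]
    refine (Real.sum_sqrt_mul_sqrt_le _ (fun i => Finset.sum_nonneg fun _ _ => sq_nonneg _)
      (fun i => Finset.sum_nonneg fun _ _ => sq_nonneg _)).trans_eq ?_
    rw [frobNorm, frobNorm, frobSq, frobSq, Finset.sum_comm]
  have hdk : (0 : ℝ) ≤ d - k := hT ▸ Nat.cast_nonneg _
  rcases Nat.eq_zero_or_pos d with rfl | hd
  · simpa [Finset.eq_empty_of_isEmpty] using herr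
  · refine herr.trans ?_
    rw [mul_assoc, div_mul_eq_mul_div, le_div_iff₀' (by exact_mod_cast hd)]
    exact havg.trans (mul_le_mul_of_nonneg_left hcs hdk)

end
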